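/- arXiv:2503.10176 — 6 statements merged into one kernel-verified Lean document; each statement's English description precedes it below -/
import Mathlib

section
/- For all natural numbers m and n, the logic NAmn enjoys the Craig interpolation property (CIP): whenever NAmn ⊢ φ → ψ, there exists a modal formula χ such that V(χ) ⊆ V(φ) ∩ V(ψ), NAmn ⊢ φ → χ, and NAmn ⊢ χ → ψ. -/
/-- Propositional formulas. -/
inductive PropForm : Type
  | var : ℕ → PropForm
  | fls : PropForm
  | and : PropForm → PropForm → PropForm
  | or : PropForm → PropForm → PropForm
  | imp : PropForm → PropForm → PropForm
  deriving DecidableEq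

/-- Boolean evaluation of a propositional formula. -/
def PropForm.eval (v : ℕ → Bool) : PropForm → Bool
  | .var i => v i
  | .fls => false
  | .and φ ψ => φ.eval v && ψ.eval v
  | .or φ ψ => φ.eval v || ψ.eval v
  | .imp φ ψ => !φ.eval v || ψ.eval v

/-- Classical propositional tautology. -/
def PropForm.Taut (φ : PropForm) : Prop := ∀ v, φ.eval v = true

/-- Modal formulas. -/
inductive ModalForm : Type
  | var : ℕ → ModalForm
  | fls : ModalForm
  | and : ModalForm → ModalForm → ModalForm
  | or : ModalForm → ModalForm → ModalForm
  | imp : ModalForm → ModalForm → ModalForm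
  | box : ModalForm → ModalForm
  deriving DecidableEq

/-- Substitution of modal formulas for the variables of a propositional formula. -/
def PropForm.subst (σ : ℕ → ModalForm) : PropForm → ModalForm
  | .var i => σ i
  | .fls => .fls
  | .and φ ψ => .and (φ.subst σ) (ψ.subst σ)
  | .or φ ψ => .or (φ.subst σ) (ψ.subst σ)
  | .imp φ ψ => .imp (φ.subst σ) (ψ.subst σ)

/-- ¬φ abbreviates φ → ⊥. -/
def ModalForm.neg (φ : ModalForm) : ModalForm := .imp φ .fls

/-- □^k φ : k-fold application of □. -/
def ModalForm.boxIter : ℕ → ModalForm → ModalForm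
  | 0, φ => φ
  | k + 1, φ => .box (ModalForm.boxIter k φ)

/-- ¬^j φ : j-fold application of ¬. -/
def ModalForm.negIter : ℕ → ModalForm → ModalForm
  | 0, φ => φ
  | k + 1, φ => (ModalForm.negIter k φ).neg

/-- φ ↔ ψ abbreviates (φ → ψ) ∧ (ψ → φ). -/
def ModalForm.iff (φ ψ : ModalForm) : ModalForm := .and (.imp φ ψ) (.imp ψ φ)

/-- Signed variables: `Vsgn φ true` is V⁺(φ), `Vsgn φ false` is V⁻(φ). -/
def ModalForm.Vsgn : ModalForm → Bool → Finset ℕ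
  | .var i, true => {i}
  | .var _, false => ∅
  | .fls, _ => ∅
  | .and φ ψ, b => φ.Vsgn b ∪ ψ.Vsgn b
  | .or φ ψ, b => φ.Vsgn b ∪ ψ.Vsgn b
  | .imp φ ψ, b => φ.Vsgn (!b) ∪ ψ.Vsgn b
  | .box φ, b => φ.Vsgn b

/-- Positive variables V⁺(φ). -/
def ModalForm.Vpos (φ : ModalForm) : Finset ℕ := φ.Vsgn true

/-- Negative variables V⁻(φ). -/
def ModalForm.Vneg (φ : ModalForm) : Finset ℕ := φ.Vsgn false

/-- All variables V(φ). -/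
def ModalForm.V (φ : ModalForm) : Finset ℕ := φ.Vpos ∪ φ.Vneg

/-- The logic NAmn = N + (Amn : □ⁿφ → □ᵐφ). -/
inductive NA (m n : ℕ) : ModalForm → Prop
  | taut (p : PropForm) (σ : ℕ → ModalForm) : p.Taut → NA m n (p.subst σ)
  | amn (φ : ModalForm) : NA m n (.imp (ModalForm.boxIter n φ) (ModalForm.boxIter m φ))
  | mp (φ ψ : ModalForm) : NA m n (.imp φ ψ) → NA m n φ → NA m n ψ
  | nec (φ : ModalForm) : NA m n φ → NA m n (.box φ)

namespace ModalForm

theorem V_and (φ ψ : ModalForm) : (φ.and ψ).V = φ.V ∪ ψ.V := by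
  ext; simp [V, Vpos, Vneg, Vsgn]; tauto

theorem V_or (φ ψ : ModalForm) : (φ.or ψ).V = φ.V ∪ ψ.V := by
  ext; simp [V, Vpos, Vneg, Vsgn]; tauto

theorem V_imp (φ ψ : ModalForm) : (φ.imp ψ).V = φ.V ∪ ψ.V := by
  ext; simp [V, Vpos, Vneg, Vsgn]; tauto

theorem V_box (φ : ModalForm) : φ.box.V = φ.V := rfl

theorem V_fls : fls.V = ∅ := rfl

theorem V_var (i : ℕ) : (var i).V = {i} := by
  simp [V, Vpos, Vneg, Vsgn]

theorem V_boxIter (k : ℕ) (φ : ModalForm) : (boxIter k φ).V = φ.V := by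
  induction k with
  | zero => rfl
  | succ k ih => rw [boxIter, V_box, ih]

end ModalForm

open ModalForm

/-- Assigns five given formulas to the variables `0, …, 4`. -/
def substFive (a b c d e : ModalForm) : ℕ → ModalForm
  | 0 => a
  | 1 => b
  | 2 => c
  | 3 => d
  | _ => e

/-- Sets of formulas containing `NA m n` and closed under modus ponens. -/
structure IsTheory (m n : ℕ) (T : Set ModalForm) : Prop where
  of_NA : ∀ α, NA m n α → α ∈ T
  mp : ∀ α β, α.imp β ∈ T → α ∈ T → β ∈ T

/-- Theories that are consistent and negation-complete. -/
structure IsCompleteTheory (m n : ℕ) (T : Set ModalForm) : Prop extends IsTheory m n T where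
  consistent : fls ∉ T
  complete : ∀ α, α ∉ T → α.neg ∈ T

theorem NA.isTheory (m n : ℕ) : IsTheory m n {α | NA m n α} :=
  ⟨fun _ h => h, NA.mp⟩

namespace IsTheory

variable {m n : ℕ} {T : Set ModalForm}

theorem taut (hT : IsTheory m n T) (p : PropForm) (hp : p.Taut) (a b c d e : ModalForm) :
    p.subst (substFive a b c d e) ∈ T :=
  hT.of_NA _ (.taut p _ hp)

theorem imp_intro (hT : IsTheory m n T) {a b : ModalForm} (hb : b ∈ T) : a.imp b ∈ T :=
  hT.mp _ _ (hT.taut (.imp (.var 1) (.imp (.var 0) (.var 1)))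
    (by intro v; simp [PropForm.eval]; grind) a b a a a) hb

theorem imp_self (hT : IsTheory m n T) (a : ModalForm) : a.imp a ∈ T :=
  hT.taut (.imp (.var 0) (.var 0)) (by intro v; simp [PropForm.eval]) a a a a a

theorem imp_mp (hT : IsTheory m n T) {a b c : ModalForm} (h : a.imp (b.imp c) ∈ T)
    (hb : a.imp b ∈ T) : a.imp c ∈ T :=
  hT.mp _ _ (hT.mp _ _ (hT.taut
    (.imp (.imp (.var 0) (.imp (.var 1) (.var 2)))
      (.imp (.imp (.var 0) (.var 1)) (.imp (.var 0) (.var 2))))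
    (by intro v; simp [PropForm.eval]; grind) a b c a a) h) hb

theorem imp_swap (hT : IsTheory m n T) {a b c : ModalForm} (h : a.imp (b.imp c) ∈ T) :
    b.imp (a.imp c) ∈ T :=
  hT.mp _ _ (hT.taut
    (.imp (.imp (.var 0) (.imp (.var 1) (.var 2))) (.imp (.var 1) (.imp (.var 0) (.var 2))))
    (by intro v; simp [PropForm.eval]; grind) a b c a a) h

theorem imp_of_imp_neg_imp_fls (hT : IsTheory m n T) {a b : ModalForm}
    (h : a.imp (b.neg.imp fls) ∈ T) : a.imp b ∈ T :=
  hT.mp _ _ (hT.taut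
    (.imp (.imp (.var 0) (.imp (.imp (.var 1) .fls) .fls)) (.imp (.var 0) (.var 1)))
    (by intro v; simp [PropForm.eval]; grind) a b a a a) h

theorem and_intro (hT : IsTheory m n T) {a b : ModalForm} (ha : a ∈ T) (hb : b ∈ T) :
    a.and b ∈ T :=
  hT.mp _ _ (hT.mp _ _ (hT.taut (.imp (.var 0) (.imp (.var 1) (.and (.var 0) (.var 1))))
    (by intro v; simp [PropForm.eval]; grind) a b a a a) ha) hb

theorem and_left (hT : IsTheory m n T) {a b : ModalForm} (h : a.and b ∈ T) : a ∈ T :=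
  hT.mp _ _ (hT.taut (.imp (.and (.var 0) (.var 1)) (.var 0))
    (by intro v; simp [PropForm.eval]; grind) a b a a a) h

theorem and_right (hT : IsTheory m n T) {a b : ModalForm} (h : a.and b ∈ T) : b ∈ T :=
  hT.mp _ _ (hT.taut (.imp (.and (.var 0) (.var 1)) (.var 1))
    (by intro v; simp [PropForm.eval]; grind) a b a a a) h

theorem or_inl (hT : IsTheory m n T) {a b : ModalForm} (h : a ∈ T) : a.or b ∈ T :=
  hT.mp _ _ (hT.taut (.imp (.var 0) (.or (.var 0) (.var 1)))
    (by intro v; simp [PropForm.eval]; grind) a b a a a) h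

theorem or_inr (hT : IsTheory m n T) {a b : ModalForm} (h : b ∈ T) : a.or b ∈ T :=
  hT.mp _ _ (hT.taut (.imp (.var 1) (.or (.var 0) (.var 1)))
    (by intro v; simp [PropForm.eval]; grind) a b a a a) h

theorem or_resolve (hT : IsTheory m n T) {a b : ModalForm} (h : a.or b ∈ T) (ha : a.neg ∈ T) :
    b ∈ T :=
  hT.mp _ _ (hT.mp _ _ (hT.taut
    (.imp (.or (.var 0) (.var 1)) (.imp (.imp (.var 0) .fls) (.var 1)))
    (by intro v; simp [PropForm.eval]; grind) a b a a a) h) ha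

theorem imp_of_neg (hT : IsTheory m n T) {a b : ModalForm} (h : a.neg ∈ T) : a.imp b ∈ T :=
  hT.mp _ _ (hT.taut (.imp (.imp (.var 0) .fls) (.imp (.var 0) (.var 1)))
    (by intro v; simp [PropForm.eval]; grind) a b a a a) h

theorem imp_and_intro (hT : IsTheory m n T) {a b c : ModalForm} (hb : a.imp b ∈ T)
    (hc : a.imp c ∈ T) : a.imp (b.and c) ∈ T :=
  hT.mp _ _ (hT.mp _ _ (hT.taut
    (.imp (.imp (.var 0) (.var 1))
      (.imp (.imp (.var 0) (.var 2)) (.imp (.var 0) (.and (.var 1) (.var 2)))))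
    (by intro v; simp [PropForm.eval]; grind) a b c a a) hb) hc

theorem and_imp_mp (hT : IsTheory m n T) {a b c d e : ModalForm}
    (h₁ : a.imp (c.imp (d.imp e)) ∈ T) (h₂ : b.imp (c.imp d) ∈ T) :
    (a.and b).imp (c.imp e) ∈ T :=
  hT.mp _ _ (hT.mp _ _ (hT.taut
    (.imp (.imp (.var 0) (.imp (.var 2) (.imp (.var 3) (.var 4))))
      (.imp (.imp (.var 1) (.imp (.var 2) (.var 3)))
        (.imp (.and (.var 0) (.var 1)) (.imp (.var 2) (.var 4)))))
    (by intro v; simp [PropForm.eval]; grind) a b c d e) h₁) h₂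

/-- The theory obtained by adjoining one formula. -/
theorem adjoin (hT : IsTheory m n T) (a : ModalForm) : IsTheory m n {b | a.imp b ∈ T} :=
  ⟨fun b h => hT.imp_intro (hT.of_NA b h), fun _ _ => hT.imp_mp⟩

/-- The theory generated by `δ` and a set of formulas closed under conjunction. -/
theorem generated {C : Set ModalForm} (δ : ModalForm) (hne : C.Nonempty)
    (hC : ∀ a ∈ C, ∀ b ∈ C, a.and b ∈ C) :
    IsTheory m n {β | ∃ χ ∈ C, NA m n (χ.imp (δ.imp β))} := by
  have hN := NA.isTheory m n
  refine ⟨fun α h => ?_, ?_⟩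
  · obtain ⟨χ, hχ⟩ := hne
    exact ⟨χ, hχ, hN.imp_intro (hN.imp_intro h)⟩
  · rintro α β ⟨χ₁, h₁, d₁⟩ ⟨χ₂, h₂, d₂⟩
    exact ⟨_, hC _ h₁ _ h₂, hN.and_imp_mp d₁ d₂⟩

/-- Lindenbaum's lemma. -/
theorem exists_complete (hT : IsTheory m n T) (hc : fls ∉ T) :
    ∃ W, T ⊆ W ∧ IsCompleteTheory m n W := by
  obtain ⟨W, hTW, hW⟩ := zorn_subset_nonempty {S | IsTheory m n S ∧ fls ∉ S}
    (fun c hcS hch ⟨S₀, hS₀⟩ => by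
      refine ⟨⋃₀ c, ⟨⟨fun α h => ⟨S₀, hS₀, (hcS hS₀).1.of_NA α h⟩, ?_⟩, ?_⟩,
        fun s hs => Set.subset_sUnion_of_mem hs⟩
      · rintro α β ⟨S₁, hS₁, h₁⟩ ⟨S₂, hS₂, h₂⟩
        rcases hch.total hS₁ hS₂ with h | h
        · exact ⟨S₂, hS₂, (hcS hS₂).1.mp _ _ (h h₁) h₂⟩
        · exact ⟨S₁, hS₁, (hcS hS₁).1.mp _ _ h₁ (h h₂)⟩
      · rintro ⟨S, hS, h⟩
        exact (hcS hS).2 h) T ⟨hT, hc⟩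
  refine ⟨W, hTW, hW.prop.1, hW.prop.2, fun α hα => ?_⟩
  by_contra hneg
  exact hα (hW.le_of_ge ⟨hW.prop.1.adjoin α, hneg⟩ (fun β hβ => hW.prop.1.imp_intro hβ)
    (hW.prop.1.imp_self α))

end IsTheory

namespace IsCompleteTheory

variable {m n : ℕ} {T : Set ModalForm} {a b : ModalForm}

theorem and_mem (hT : IsCompleteTheory m n T) : a.and b ∈ T ↔ a ∈ T ∧ b ∈ T :=
  ⟨fun h => ⟨hT.and_left h, hT.and_right h⟩, fun h => hT.and_intro h.1 h.2⟩

theorem or_mem (hT : IsCompleteTheory m n T) : a.or b ∈ T ↔ a ∈ T ∨ b ∈ T := by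
  refine ⟨fun h => ?_, fun h => h.elim hT.or_inl hT.or_inr⟩
  by_contra! hab
  exact hab.2 (hT.or_resolve h (hT.complete _ hab.1))

theorem imp_mem (hT : IsCompleteTheory m n T) : a.imp b ∈ T ↔ (a ∈ T → b ∈ T) := by
  refine ⟨hT.mp a b, fun h => ?_⟩
  by_cases ha : a ∈ T
  · exact hT.imp_intro (h ha)
  · exact hT.imp_of_neg (hT.complete _ ha)

theorem neg_mem (hT : IsCompleteTheory m n T) : a.neg ∈ T ↔ a ∉ T :=
  ⟨fun h ha => hT.consistent (hT.mp _ _ h ha), hT.complete a⟩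

end IsCompleteTheory

/-- Truth of a formula when the variables and boxed formulas over `A` are read off from `S`, those
over `B` from `T`, and `□` is the identity on all other formulas. -/
def amalgam (A B : Finset ℕ) (S T : Set ModalForm) : ModalForm → Prop
  | .var i => if i ∈ A then .var i ∈ S else .var i ∈ T
  | .fls => False
  | .and α β => amalgam A B S T α ∧ amalgam A B S T β
  | .or α β => amalgam A B S T α ∨ amalgam A B S T β
  | .imp α β => amalgam A B S T α → amalgam A B S T β
  | .box α =>
    if α.V ⊆ A then α.box ∈ S else if α.V ⊆ B then α.box ∈ T else amalgam A B S T α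

section Amalgam

variable {m n : ℕ} {A B : Finset ℕ} {S T : Set ModalForm}

theorem amalgam_iff_left (hS : IsCompleteTheory m n S) (α : ModalForm) (hα : α.V ⊆ A) :
    amalgam A B S T α ↔ α ∈ S := by
  induction α with
  | var i =>
    have : i ∈ A := hα (by simp [V_var])
    simp [amalgam, this]
  | fls => simp [amalgam, hS.consistent]
  | and α β ihα ihβ =>
    rw [V_and, Finset.union_subset_iff] at hα
    rw [amalgam, ihα hα.1, ihβ hα.2, hS.and_mem]
  | or α β ihα ihβ =>
    rw [V_or, Finset.union_subset_iff] at hα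
    rw [amalgam, ihα hα.1, ihβ hα.2, hS.or_mem]
  | imp α β ihα ihβ =>
    rw [V_imp, Finset.union_subset_iff] at hα
    rw [amalgam, ihα hα.1, ihβ hα.2, hS.imp_mem]
  | box α _ =>
    rw [V_box] at hα
    rw [amalgam, if_pos hα]

theorem amalgam_iff_right (hT : IsCompleteTheory m n T)
    (hST : ∀ α : ModalForm, α.V ⊆ A ∩ B → (α ∈ S ↔ α ∈ T)) (α : ModalForm) (hα : α.V ⊆ B) :
    amalgam A B S T α ↔ α ∈ T := by
  induction α with
  | var i =>
    have hB : i ∈ B := hα (by simp [V_var])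
    rw [amalgam]
    split_ifs with hA
    · exact hST _ (by simp [V_var, hA, hB])
    · rfl
  | fls => simp [amalgam, hT.consistent]
  | and α β ihα ihβ =>
    rw [V_and, Finset.union_subset_iff] at hα
    rw [amalgam, ihα hα.1, ihβ hα.2, hT.and_mem]
  | or α β ihα ihβ =>
    rw [V_or, Finset.union_subset_iff] at hα
    rw [amalgam, ihα hα.1, ihβ hα.2, hT.or_mem]
  | imp α β ihα ihβ =>
    rw [V_imp, Finset.union_subset_iff] at hα
    rw [amalgam, ihα hα.1, ihβ hα.2, hT.imp_mem]
  | box α _ =>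
    rw [V_box] at hα
    rw [amalgam]
    split_ifs with hA
    · exact hST _ (Finset.subset_inter hA hα)
    · rfl

theorem amalgam_boxIter {α : ModalForm} (hA : ¬ α.V ⊆ A) (hB : ¬ α.V ⊆ B) (k : ℕ) :
    amalgam A B S T (boxIter k α) ↔ amalgam A B S T α := by
  induction k with
  | zero => rfl
  | succ k ih =>
    rw [boxIter, amalgam, V_boxIter, if_neg hA, if_neg hB, ih]

open Classical in
theorem amalgam_subst (σ : ℕ → ModalForm) (p : PropForm) :
    amalgam A B S T (p.subst σ) ↔ p.eval (fun i => decide (amalgam A B S T (σ i))) = true := by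
  induction p with
  | var i => simp [PropForm.subst, PropForm.eval]
  | fls => simp [PropForm.subst, PropForm.eval, amalgam]
  | and p q ihp ihq => simp [PropForm.subst, PropForm.eval, amalgam, ihp, ihq]
  | or p q ihp ihq => simp [PropForm.subst, PropForm.eval, amalgam, ihp, ihq]
  | imp p q ihp ihq =>
    simp [PropForm.subst, PropForm.eval, amalgam, ihp, ihq]
    grind

theorem NA.amalgam (hS : IsCompleteTheory m n S) (hT : IsCompleteTheory m n T)
    (hST : ∀ α : ModalForm, α.V ⊆ A ∩ B → (α ∈ S ↔ α ∈ T)) {α : ModalForm} (h : NA m n α) :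
    amalgam A B S T α := by
  induction h with
  | taut p σ hp => exact (amalgam_subst σ p).2 (hp _)
  | amn α =>
    have hV : (ModalForm.imp (boxIter n α) (boxIter m α)).V = α.V := by
      rw [V_imp, V_boxIter, V_boxIter, Finset.union_self]
    by_cases hA : α.V ⊆ A
    · exact (amalgam_iff_left hS _ (hV ▸ hA)).2 (hS.of_NA _ (.amn α))
    by_cases hB : α.V ⊆ B
    · exact (amalgam_iff_right hT hST _ (hV ▸ hB)).2 (hT.of_NA _ (.amn α))
    rw [_root_.amalgam, amalgam_boxIter hA hB, amalgam_boxIter hA hB]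
    exact id
  | mp α β _ _ ihαβ ihα => exact ihαβ ihα
  | nec α h ih =>
    rw [_root_.amalgam]
    split_ifs
    · exact hS.of_NA _ (.nec α h)
    · exact hT.of_NA _ (.nec α h)
    · exact ih

end Amalgam

/-- NA enjoys the Craig interpolation property. -/
theorem NA_CIP (m n : ℕ) (φ ψ : ModalForm) (h : NA m n (.imp φ ψ)) :
    ∃ χ : ModalForm,
      χ.V ⊆ φ.V ∩ ψ.V ∧ NA m n (.imp φ χ) ∧ NA m n (.imp χ ψ) := by
  by_contra hno
  have hN := NA.isTheory m n
  have hand {a b : ModalForm} (ha : a.V ⊆ φ.V ∩ ψ.V) (hb : b.V ⊆ φ.V ∩ ψ.V) :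
      (a.and b).V ⊆ φ.V ∩ ψ.V := by
    rw [V_and]
    exact Finset.union_subset ha hb
  have hneg {a : ModalForm} (ha : a.V ⊆ φ.V ∩ ψ.V) : a.neg.V ⊆ φ.V ∩ ψ.V := by
    rw [neg, V_imp, V_fls, Finset.union_empty]
    exact ha
  have htop : (fls.imp fls).V ⊆ φ.V ∩ ψ.V := hneg (Finset.empty_subset _)
  -- a complete theory refuting `ψ` and containing every consequence of `φ` in the common language
  obtain ⟨T, hsubT, hT⟩ := (IsTheory.generated (m := m) (n := n)
      (C := {χ | χ.V ⊆ φ.V ∩ ψ.V ∧ NA m n (φ.imp χ)}) ψ.neg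
      ⟨_, htop, hN.imp_intro (hN.imp_self _)⟩
      (fun a ha b hb => ⟨hand ha.1 hb.1, hN.imp_and_intro ha.2 hb.2⟩)).exists_complete (by
    rintro ⟨χ, hχ, hd⟩
    exact hno ⟨χ, hχ.1, hχ.2, hN.imp_of_imp_neg_imp_fls hd⟩)
  have hψ : ψ ∉ T := hT.neg_mem.1 (hsubT ⟨_, ⟨htop, hN.imp_intro (hN.imp_self _)⟩,
    hN.imp_intro (hN.imp_self _)⟩)
  have hφT {χ : ModalForm} (hχ : χ.V ⊆ φ.V ∩ ψ.V) (hd : NA m n (φ.imp χ)) : χ ∈ T :=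
    hsubT ⟨χ, ⟨hχ, hd⟩, hN.imp_swap (hN.imp_intro (hN.imp_self χ))⟩
  -- a complete theory containing `φ` that agrees with `T` on the common language
  obtain ⟨S, hsubS, hS⟩ := (IsTheory.generated (m := m) (n := n)
      (C := {χ | χ.V ⊆ φ.V ∩ ψ.V ∧ χ ∈ T}) φ
      ⟨_, htop, hT.imp_self _⟩
      (fun a ha b hb => ⟨hand ha.1 hb.1, hT.and_intro ha.2 hb.2⟩)).exists_complete (by
    rintro ⟨χ, hχ, hd⟩
    exact hT.neg_mem.1 (hφT (hneg hχ.1) (hN.imp_swap hd)) hχ.2)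
  have hφ : φ ∈ S := hsubS ⟨_, ⟨htop, hT.imp_self _⟩, hN.imp_intro (hN.imp_self φ)⟩
  have hTS {χ : ModalForm} (hχ : χ.V ⊆ φ.V ∩ ψ.V) (hd : χ ∈ T) : χ ∈ S :=
    hsubS ⟨χ, ⟨hχ, hd⟩, hN.imp_swap (hN.imp_intro (hN.imp_self χ))⟩
  have hST (α : ModalForm) (hα : α.V ⊆ φ.V ∩ ψ.V) : α ∈ S ↔ α ∈ T := by
    refine ⟨fun hαS => ?_, hTS hα⟩
    by_contra hαT
    exact hS.neg_mem.1 (hTS (hneg hα) (hT.complete _ hαT)) hαS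
  exact hψ ((amalgam_iff_right hT hST ψ subset_rfl).1
    (h.amalgam hS hT hST ((amalgam_iff_left hS φ subset_rfl).2 hφ)))
end

section
/- Let L be a set of modal formulas containing all substitution instances (by modal formulas) of classical propositional tautologies and closed under modus ponens, where L ⊢ φ means φ ∈ L. If L is locally tabular and enjoys the Craig interpolation property (CIP), then L enjoys the uniform interpolation property (UIP). -/
/-- L enjoys the uniform Lyndon interpolation property. -/
def ULIP (L : ModalForm → Prop) : Prop :=
  ∀ (φ : ModalForm) (Pp Pm : Finset ℕ),
    ∃ χ : ModalForm,
      χ.Vpos ⊆ φ.Vpos \ Pp ∧ χ.Vneg ⊆ φ.Vneg \ Pm ∧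
      L (.imp φ χ) ∧
      ∀ ψ : ModalForm, L (.imp φ ψ) →
        ψ.Vpos ∩ Pp = ∅ → ψ.Vneg ∩ Pm = ∅ → L (.imp χ ψ)

/-- L enjoys the uniform interpolation property. -/
def UIP (L : ModalForm → Prop) : Prop :=
  ∀ (φ : ModalForm) (P : Finset ℕ),
    ∃ χ : ModalForm,
      χ.V ⊆ φ.V \ P ∧ L (.imp φ χ) ∧
      ∀ ψ : ModalForm, L (.imp φ ψ) → ψ.V ∩ P = ∅ → L (.imp χ ψ)

/-- L enjoys the Lyndon interpolation property. -/
def LIP (L : ModalForm → Prop) : Prop :=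
  ∀ φ ψ : ModalForm, L (.imp φ ψ) →
    ∃ χ : ModalForm,
      χ.Vpos ⊆ φ.Vpos ∩ ψ.Vpos ∧ χ.Vneg ⊆ φ.Vneg ∩ ψ.Vneg ∧
      L (.imp φ χ) ∧ L (.imp χ ψ)

/-- L enjoys the Craig interpolation property. -/
def CIP (L : ModalForm → Prop) : Prop :=
  ∀ φ ψ : ModalForm, L (.imp φ ψ) →
    ∃ χ : ModalForm, χ.V ⊆ φ.V ∩ ψ.V ∧ L (.imp φ χ) ∧ L (.imp χ ψ)

/-- L is locally tabular: for each finite set P of variables, there are only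
finitely many equivalence classes (witnessed by a finite set of representatives)
of formulas over P modulo L-provable equivalence. -/
def LocallyTabular (L : ModalForm → Prop) : Prop :=
  ∀ P : Finset ℕ, ∃ S : Finset ModalForm,
    ∀ φ : ModalForm, φ.V ⊆ P → ∃ χ ∈ S, L (φ.iff χ)

theorem ModalForm.V_and_s12 (φ ψ : ModalForm) : (ModalForm.and φ ψ).V = φ.V ∪ ψ.V := by
  ext; simp [ModalForm.V, ModalForm.Vpos, ModalForm.Vneg, ModalForm.Vsgn]; tauto

section PropositionalReasoning

variable {L : ModalForm → Prop}
  (htaut : ∀ (p : PropForm) (σ : ℕ → ModalForm), p.Taut → L (p.subst σ))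
  (hmp : ∀ φ ψ : ModalForm, L (.imp φ ψ) → L φ → L ψ)

include htaut

theorem imp_fls_imp_fls (φ : ModalForm) : L (.imp φ (.imp .fls .fls)) :=
  htaut (.imp (.var 0) (.imp .fls .fls)) (fun _ => φ) fun v => by simp [PropForm.eval]

theorem and_imp_left (φ ψ : ModalForm) : L (.imp (.and φ ψ) φ) :=
  htaut (.imp (.and (.var 0) (.var 1)) (.var 0)) (fun | 0 => φ | _ => ψ) fun v => by
    cases h : v 0 <;> simp [PropForm.eval, h]

theorem and_imp_right (φ ψ : ModalForm) : L (.imp (.and φ ψ) ψ) :=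
  htaut (.imp (.and (.var 0) (.var 1)) (.var 1)) (fun | 0 => φ | _ => ψ) fun v => by
    cases h : v 1 <;> simp [PropForm.eval, h]

include hmp

theorem imp_trans_of_taut {φ ψ χ : ModalForm} (h₁ : L (.imp φ ψ)) (h₂ : L (.imp ψ χ)) :
    L (.imp φ χ) := by
  refine hmp _ _ (hmp _ _ (htaut (.imp (.imp (.var 0) (.var 1))
    (.imp (.imp (.var 1) (.var 2)) (.imp (.var 0) (.var 2))))
    (fun | 0 => φ | 1 => ψ | _ => χ) fun v => ?_) h₁) h₂
  cases hφ : v 0 <;> cases hψ : v 1 <;> cases hχ : v 2 <;> simp [PropForm.eval, hφ, hψ, hχ]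

theorem imp_and_of_taut {φ ψ χ : ModalForm} (h₁ : L (.imp φ ψ)) (h₂ : L (.imp φ χ)) :
    L (.imp φ (.and ψ χ)) := by
  refine hmp _ _ (hmp _ _ (htaut (.imp (.imp (.var 0) (.var 1))
    (.imp (.imp (.var 0) (.var 2)) (.imp (.var 0) (.and (.var 1) (.var 2)))))
    (fun | 0 => φ | 1 => ψ | _ => χ) fun v => ?_) h₁) h₂
  cases hφ : v 0 <;> cases hψ : v 1 <;> cases hχ : v 2 <;> simp [PropForm.eval, hφ, hψ, hχ]

/-- Among the consequences of `φ` over `Q` that are equivalent to a member of the finite set `S`,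
there is a lower bound which is itself a consequence of `φ` over `Q`. -/
theorem exists_lower_bound_consequences (φ : ModalForm) (Q : Finset ℕ) (S : Finset ModalForm) :
    ∃ χ : ModalForm, χ.V ⊆ Q ∧ L (.imp φ χ) ∧
      ∀ θ : ModalForm, θ.V ⊆ Q → L (.imp φ θ) → (∃ s ∈ S, L (θ.iff s)) → L (.imp χ θ) := by
  induction S using Finset.induction_on with
  | empty =>
    exact ⟨.imp .fls .fls,
      by simp [ModalForm.V, ModalForm.Vpos, ModalForm.Vneg, ModalForm.Vsgn],
      imp_fls_imp_fls htaut φ, by simp⟩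
  | insert s S _ ih =>
    obtain ⟨χ, hχQ, hφχ, hχ⟩ := ih
    by_cases h : ∃ θ : ModalForm, θ.V ⊆ Q ∧ L (.imp φ θ) ∧ L (θ.iff s)
    · obtain ⟨θ₀, hθ₀Q, hφθ₀, hθ₀s⟩ := h
      refine ⟨.and χ θ₀, ?_, imp_and_of_taut htaut hmp hφχ hφθ₀, ?_⟩
      · rw [ModalForm.V_and_s12]
        exact Finset.union_subset hχQ hθ₀Q
      · rintro θ hθQ hφθ ⟨t, ht, hθt⟩
        rcases Finset.mem_insert.mp ht with rfl | ht
        · have h₁ : L (.imp θ₀ t) := hmp _ _ (and_imp_left htaut _ _) hθ₀s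
          have h₂ : L (.imp t θ) := hmp _ _ (and_imp_right htaut _ _) hθt
          exact imp_trans_of_taut htaut hmp (and_imp_right htaut _ _)
            (imp_trans_of_taut htaut hmp h₁ h₂)
        · exact imp_trans_of_taut htaut hmp (and_imp_left htaut _ _) (hχ θ hθQ hφθ ⟨t, ht, hθt⟩)
    · refine ⟨χ, hχQ, hφχ, ?_⟩
      rintro θ hθQ hφθ ⟨t, ht, hθt⟩
      rcases Finset.mem_insert.mp ht with rfl | ht
      · exact absurd ⟨θ, hθQ, hφθ, hθt⟩ h
      · exact hχ θ hθQ hφθ ⟨t, ht, hθt⟩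

end PropositionalReasoning

/-- For a locally tabular logic containing all substitution instances of classical
tautologies and closed under modus ponens, CIP implies UIP. -/
theorem locally_tabular_cip_implies_uip (L : ModalForm → Prop)
    (htaut : ∀ (p : PropForm) (σ : ℕ → ModalForm), p.Taut → L (p.subst σ))
    (hmp : ∀ φ ψ : ModalForm, L (.imp φ ψ) → L φ → L ψ)
    (hlt : LocallyTabular L) (hcip : CIP L) : UIP L := by
  intro φ P
  obtain ⟨S, hS⟩ := hlt (φ.V \ P)
  obtain ⟨χ, hχV, hφχ, hχ⟩ := exists_lower_bound_consequences htaut hmp φ (φ.V \ P) S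
  refine ⟨χ, hχV, hφχ, fun ψ hφψ hψP => ?_⟩
  obtain ⟨θ, hθV, hφθ, hθψ⟩ := hcip φ ψ hφψ
  have hθ : θ.V ⊆ φ.V \ P := fun x hx => by
    obtain ⟨hxφ, hxψ⟩ := Finset.mem_inter.mp (hθV hx)
    exact Finset.mem_sdiff.mpr
      ⟨hxφ, Finset.disjoint_left.mp (Finset.disjoint_iff_inter_eq_empty.mpr hψP) hxψ⟩
  exact imp_trans_of_taut htaut hmp (hχ θ hθ hφθ (hS θ hθ)) hθψ
end

section
/- Classical propositional logic Cl enjoys the uniform Lyndon interpolation property (ULIP): for every propositional formula φ and all finite sets P⁺, P⁻ of propositional variables, there exists a propositional formula χ such that V^•(χ) ⊆ V^•(φ) \ P^• for each • ∈ {+,−}, Cl ⊢ φ → χ, and Cl ⊢ χ → ψ for every propositional formula ψ such that Cl ⊢ φ → ψ and V^•(ψ) ∩ P^• = ∅ for each • ∈ {+,−}. -/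
/-- φ ↔ ψ abbreviates (φ → ψ) ∧ (ψ → φ). -/
def PropForm.iff (φ ψ : PropForm) : PropForm := .and (.imp φ ψ) (.imp ψ φ)

/-- Signed variables: `Vsgn φ true` is V⁺(φ), `Vsgn φ false` is V⁻(φ). -/
def PropForm.Vsgn : PropForm → Bool → Finset ℕ
  | .var i, true => {i}
  | .var _, false => ∅
  | .fls, _ => ∅
  | .and φ ψ, b => φ.Vsgn b ∪ ψ.Vsgn b
  | .or φ ψ, b => φ.Vsgn b ∪ ψ.Vsgn b
  | .imp φ ψ, b => φ.Vsgn (!b) ∪ ψ.Vsgn b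

/-- Positive variables V⁺(φ). -/
def PropForm.Vpos (φ : PropForm) : Finset ℕ := φ.Vsgn true

/-- Negative variables V⁻(φ). -/
def PropForm.Vneg (φ : PropForm) : Finset ℕ := φ.Vsgn false

/-- All variables V(φ). -/
def PropForm.V (φ : PropForm) : Finset ℕ := φ.Vpos ∪ φ.Vneg

namespace PropForm

/-- Truth of a formula is monotone in its positive and antitone in its negative variables. -/
theorem eval_mono (φ : PropForm) {v w : ℕ → Bool}
    (hpos : ∀ x ∈ φ.Vsgn true, v x = true → w x = true)
    (hneg : ∀ x ∈ φ.Vsgn false, w x = true → v x = true)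
    (h : φ.eval v = true) : φ.eval w = true := by
  induction φ generalizing v w with
  | var i => exact hpos i (by simp [Vsgn]) h
  | fls => exact h
  | and φ ψ ih₁ ih₂ =>
    simp only [Vsgn, Finset.mem_union, eval, Bool.and_eq_true] at *
    exact ⟨ih₁ (fun x hx => hpos x (.inl hx)) (fun x hx => hneg x (.inl hx)) h.1,
      ih₂ (fun x hx => hpos x (.inr hx)) (fun x hx => hneg x (.inr hx)) h.2⟩
  | or φ ψ ih₁ ih₂ =>
    simp only [Vsgn, Finset.mem_union, eval, Bool.or_eq_true] at *
    exact h.imp (ih₁ (fun x hx => hpos x (.inl hx)) (fun x hx => hneg x (.inl hx)))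
      (ih₂ (fun x hx => hpos x (.inr hx)) (fun x hx => hneg x (.inr hx)))
  | imp φ ψ ih₁ ih₂ =>
    simp only [Vsgn, Finset.mem_union, eval, Bool.or_eq_true, Bool.not_eq_true', Bool.not_true,
      Bool.not_false, ← Bool.not_eq_true] at *
    exact h.imp
      (mt (ih₁ (fun x hx => hneg x (.inl hx)) (fun x hx => hpos x (.inl hx))))
      (ih₂ (fun x hx => hpos x (.inr hx)) (fun x hx => hneg x (.inr hx)))

theorem taut_imp_iff {φ ψ : PropForm} :
    (imp φ ψ).Taut ↔ ∀ v, φ.eval v = true → ψ.eval v = true := by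
  simp [Taut, eval, ← Bool.not_eq_true, imp_iff_not_or]

/-- Conjunction of a list of formulas. -/
def conj (l : List PropForm) : PropForm := l.foldr and (imp fls fls)

/-- Disjunction of a list of formulas. -/
def disj (l : List PropForm) : PropForm := l.foldr or fls

theorem eval_conj (v : ℕ → Bool) (l : List PropForm) :
    (conj l).eval v = true ↔ ∀ φ ∈ l, φ.eval v = true := by
  induction l with
  | nil => simp [conj, eval]
  | cons φ l ih => simpa [conj, eval] using fun _ => ih

theorem eval_disj (v : ℕ → Bool) (l : List PropForm) :
    (disj l).eval v = true ↔ ∃ φ ∈ l, φ.eval v = true := by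
  induction l with
  | nil => simp [disj, eval]
  | cons φ l ih => simpa [disj, eval] using or_congr_right ih

theorem mem_Vsgn_conj {b : Bool} {x : ℕ} {l : List PropForm} :
    x ∈ (conj l).Vsgn b ↔ ∃ φ ∈ l, x ∈ φ.Vsgn b := by
  induction l with
  | nil => simp [conj, Vsgn]
  | cons φ l ih => simpa [conj, Vsgn] using or_congr_right ih

theorem mem_Vsgn_disj {b : Bool} {x : ℕ} {l : List PropForm} :
    x ∈ (disj l).Vsgn b ↔ ∃ φ ∈ l, x ∈ φ.Vsgn b := by
  induction l with
  | nil => simp [disj, Vsgn]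
  | cons φ l ih => simpa [disj, Vsgn] using or_congr_right ih

/-- The formula saying that all variables in `A` are true and all variables in `B` are false. -/
noncomputable def literals (A B : Finset ℕ) : PropForm :=
  and (conj (A.toList.map var)) (conj (B.toList.map fun x => imp (var x) fls))

theorem eval_literals (v : ℕ → Bool) (A B : Finset ℕ) :
    (literals A B).eval v = true ↔ (∀ x ∈ A, v x = true) ∧ ∀ x ∈ B, v x = false := by
  simp [literals, eval, eval_conj]

theorem Vsgn_literals_true (A B : Finset ℕ) : (literals A B).Vsgn true = A := by
  ext x; simp [literals, Vsgn, mem_Vsgn_conj]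

theorem Vsgn_literals_false (A B : Finset ℕ) : (literals A B).Vsgn false = B := by
  ext x; simp [literals, Vsgn, mem_Vsgn_conj]

/-- The disjunction, over all models `D` of `φ`, of the restriction of the diagram of `D` to
positive literals from `A` and negative literals from `B`. -/
noncomputable def diagramDisj (φ : PropForm) (A B : Finset ℕ) : PropForm :=
  disj ((φ.V.powerset.filter fun D => φ.eval (fun x => decide (x ∈ D)) = true).toList.map
    fun D => literals (A ∩ D) (B \ D))

theorem eval_diagramDisj (v : ℕ → Bool) (φ : PropForm) (A B : Finset ℕ) :
    (φ.diagramDisj A B).eval v = true ↔ ∃ D ⊆ φ.V, φ.eval (fun x => decide (x ∈ D)) = true ∧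
      (∀ x ∈ A, x ∈ D → v x = true) ∧ ∀ x ∈ B, x ∉ D → v x = false := by
  simp [diagramDisj, eval_disj, eval_literals, and_assoc]

theorem Vpos_diagramDisj_subset (φ : PropForm) (A B : Finset ℕ) :
    (φ.diagramDisj A B).Vpos ⊆ A := by
  intro x hx
  simp only [Vpos, diagramDisj, mem_Vsgn_disj, List.mem_map] at hx
  obtain ⟨_, ⟨D, -, rfl⟩, hx⟩ := hx
  rw [Vsgn_literals_true] at hx
  exact Finset.inter_subset_left hx

theorem Vneg_diagramDisj_subset (φ : PropForm) (A B : Finset ℕ) :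
    (φ.diagramDisj A B).Vneg ⊆ B := by
  intro x hx
  simp only [Vneg, diagramDisj, mem_Vsgn_disj, List.mem_map] at hx
  obtain ⟨_, ⟨D, -, rfl⟩, hx⟩ := hx
  rw [Vsgn_literals_false] at hx
  exact Finset.sdiff_subset hx

theorem eval_diagramDisj_of_eval {v : ℕ → Bool} {φ : PropForm} {A B : Finset ℕ}
    (hB : B ⊆ φ.V) (h : φ.eval v = true) : (φ.diagramDisj A B).eval v = true := by
  refine (eval_diagramDisj v φ A B).2
    ⟨φ.V.filter fun x => v x = true, Finset.filter_subset _ _, ?_, ?_, ?_⟩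
  · refine φ.eval_mono (fun x hx hv => ?_) (fun x _ hv => ?_) h
    · simp [V, Vpos, hx, hv]
    · simp_all
  · simp
  · intro x hx hv
    simpa [hB hx] using hv

/-- If the constraints imposed by `w` on `v` cover all the signed variables shared by `φ` and `ψ`,
then there is a valuation that is above `w` with respect to `φ` and below `v` with respect
to `ψ`. -/
theorem eval_of_taut_imp {φ ψ : PropForm} (h : (imp φ ψ).Taut) {v w : ℕ → Bool}
    (hw : φ.eval w = true)
    (hpos : ∀ x ∈ φ.Vsgn true, x ∈ ψ.Vsgn true → w x = true → v x = true)
    (hneg : ∀ x ∈ φ.Vsgn false, x ∈ ψ.Vsgn false → w x = false → v x = false) :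
    ψ.eval v = true := by
  let u : ℕ → Bool := fun x =>
    if x ∈ ψ.Vsgn true then if x ∈ ψ.Vsgn false then v x else w x && v x
    else if x ∈ ψ.Vsgn false then w x || v x else w x
  have hu : φ.eval u = true := by
    refine φ.eval_mono (fun x hx => ?_) (fun x hx => ?_) hw
    · have := hpos x hx
      grind
    · have := hneg x hx
      grind
  refine ψ.eval_mono (fun x hx => ?_) (fun x hx => ?_) (taut_imp_iff.1 h u hu)
  · grind
  · grind

end PropForm

/-- Classical propositional logic enjoys the uniform Lyndon interpolation property. -/
theorem Cl_ULIP (φ : PropForm) (Pp Pm : Finset ℕ) :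
    ∃ χ : PropForm,
      χ.Vpos ⊆ φ.Vpos \ Pp ∧ χ.Vneg ⊆ φ.Vneg \ Pm ∧
      PropForm.Taut (.imp φ χ) ∧
      ∀ ψ : PropForm, PropForm.Taut (.imp φ ψ) →
        ψ.Vpos ∩ Pp = ∅ → ψ.Vneg ∩ Pm = ∅ → PropForm.Taut (.imp χ ψ) := by
  refine ⟨φ.diagramDisj (φ.Vpos \ Pp) (φ.Vneg \ Pm), φ.Vpos_diagramDisj_subset _ _,
    φ.Vneg_diagramDisj_subset _ _, PropForm.taut_imp_iff.2 fun v =>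
      PropForm.eval_diagramDisj_of_eval
        (Finset.sdiff_subset.trans Finset.subset_union_right), ?_⟩
  intro ψ hψ hp hm
  rw [← Finset.disjoint_iff_inter_eq_empty] at hp hm
  refine PropForm.taut_imp_iff.2 fun v hv => ?_
  obtain ⟨D, -, hD, hA, hB⟩ := (PropForm.eval_diagramDisj v φ _ _).1 hv
  refine PropForm.eval_of_taut_imp hψ hD (fun x hφ hx hxD => ?_) (fun x hφ hx hxD => ?_)
  · exact hA x (Finset.mem_sdiff.2 ⟨hφ, Finset.disjoint_left.1 hp hx⟩) (of_decide_eq_true hxD)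
  · exact hB x (Finset.mem_sdiff.2 ⟨hφ, Finset.disjoint_left.1 hm hx⟩) (of_decide_eq_false hxD)
end

section
/- For all natural numbers m and n, the rule Ros□ is admissible in the normal modal logic K+Amn: for every modal formula φ, if K+Amn ⊢ ¬□φ, then K+Amn ⊢ ¬□□φ. -/
/-- The normal modal logic K + Amn. -/
inductive KA (m n : ℕ) : ModalForm → Prop
  | taut (p : PropForm) (σ : ℕ → ModalForm) : p.Taut → KA m n (p.subst σ)
  | kax (φ ψ : ModalForm) :
      KA m n (.imp (.box (.imp φ ψ)) (.imp (.box φ) (.box ψ)))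
  | amn (φ : ModalForm) : KA m n (.imp (ModalForm.boxIter n φ) (ModalForm.boxIter m φ))
  | mp (φ ψ : ModalForm) : KA m n (.imp φ ψ) → KA m n φ → KA m n ψ
  | nec (φ : ModalForm) : KA m n φ → KA m n (.box φ)

/-- Provable implications compose. -/
theorem KA.imp_trans {m n : ℕ} {φ ψ χ : ModalForm}
    (h₁ : KA m n (.imp φ ψ)) (h₂ : KA m n (.imp ψ χ)) : KA m n (.imp φ χ) := by
  let p : PropForm := .imp (.imp (.var 0) (.var 1))
    (.imp (.imp (.var 1) (.var 2)) (.imp (.var 0) (.var 2)))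
  let σ : ℕ → ModalForm := fun i => if i = 0 then φ else if i = 1 then ψ else χ
  have hp : p.Taut := by
    intro v
    simp only [p, PropForm.eval]
    cases v 0 <;> cases v 1 <;> cases v 2 <;> rfl
  exact .mp _ _ (.mp _ _ (.taut p σ hp) h₁) h₂

/-- Ex falso. -/
theorem KA.fls_imp {m n : ℕ} (φ : ModalForm) : KA m n (.imp .fls φ) :=
  .taut (.imp .fls (.var 0)) (fun _ => φ) fun _ => rfl

/-- The box is monotone with respect to provable implication. -/
theorem KA.box_mono {m n : ℕ} {φ ψ : ModalForm}
    (h : KA m n (.imp φ ψ)) : KA m n (.imp (.box φ) (.box ψ)) :=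
  .mp _ _ (.kax φ ψ) (.nec _ h)

/-- The rule Ros□ is admissible in K + Amn. -/
theorem KA_rosbox_admissible (m n : ℕ) (φ : ModalForm)
    (h : KA m n (ModalForm.neg (.box φ))) :
    KA m n (ModalForm.neg (.box (.box φ))) :=
  KA.imp_trans (KA.box_mono h) (KA.imp_trans (KA.box_mono (KA.fls_imp φ)) h)
end

section
/- For every natural number n ≥ 2, the inclusion of NA0n in NpA0n is strict: there exists a modal formula φ such that NpA0n ⊢ φ but NA0n ⊬ φ (where NA0n and NpA0n denote NAmn and NpAmn with m = 0). -/
/-- The logic NpAmn = NAmn + (Ros□ : from ¬□φ infer ¬□□φ). -/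
inductive NpA (m n : ℕ) : ModalForm → Prop
  | taut (p : PropForm) (σ : ℕ → ModalForm) : p.Taut → NpA m n (p.subst σ)
  | amn (φ : ModalForm) : NpA m n (.imp (ModalForm.boxIter n φ) (ModalForm.boxIter m φ))
  | mp (φ ψ : ModalForm) : NpA m n (.imp φ ψ) → NpA m n φ → NpA m n ψ
  | nec (φ : ModalForm) : NpA m n φ → NpA m n (.box φ)
  | rosbox (φ : ModalForm) : NpA m n (ModalForm.neg (.box φ)) →
      NpA m n (ModalForm.neg (.box (.box φ)))

/-- Truth at a world that sees exactly itself, all variables being false. -/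
def ModalForm.evalRefl : ModalForm → Bool
  | .var _ => false
  | .fls => false
  | .and φ ψ => φ.evalRefl && ψ.evalRefl
  | .or φ ψ => φ.evalRefl || ψ.evalRefl
  | .imp φ ψ => !φ.evalRefl || ψ.evalRefl
  | .box φ => φ.evalRefl

/-- Truth at a world that sees itself and the world of `evalRefl`, except that it sees no world
when evaluating `□⊥` and `□□ⁿ⊥`. -/
def ModalForm.evalException (n : ℕ) : ModalForm → Bool
  | .var _ => false
  | .fls => false
  | .and φ ψ => φ.evalException n && ψ.evalException n
  | .or φ ψ => φ.evalException n || ψ.evalException n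
  | .imp φ ψ => !φ.evalException n || ψ.evalException n
  | .box φ => decide (φ = .fls ∨ φ = ModalForm.boxIter n .fls) ||
      (φ.evalRefl && φ.evalException n)

theorem PropForm.evalRefl_subst (σ : ℕ → ModalForm) (p : PropForm) :
    (p.subst σ).evalRefl = p.eval (fun i => (σ i).evalRefl) := by
  induction p <;> simp_all [PropForm.subst, PropForm.eval, ModalForm.evalRefl]

theorem PropForm.evalException_subst (n : ℕ) (σ : ℕ → ModalForm) (p : PropForm) :
    (p.subst σ).evalException n = p.eval (fun i => (σ i).evalException n) := by
  induction p <;> simp_all [PropForm.subst, PropForm.eval, ModalForm.evalException]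

theorem ModalForm.evalRefl_boxIter (k : ℕ) (φ : ModalForm) :
    (boxIter k φ).evalRefl = φ.evalRefl := by
  induction k with
  | zero => rfl
  | succ k ih => exact ih

theorem ModalForm.boxIter_succ_eq (k : ℕ) (φ : ModalForm) :
    boxIter (k + 1) φ = boxIter k (.box φ) := by
  induction k with
  | zero => rfl
  | succ k ih => exact congrArg ModalForm.box ih

theorem ModalForm.boxIter_injective (k : ℕ) : Function.Injective (boxIter k) := by
  induction k with
  | zero => exact fun _ _ h => h
  | succ k ih => exact fun _ _ h => ih (ModalForm.box.inj h)

/-- The exceptions are false at the world of `evalRefl`, so formulas true there behave as under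
a reflexive relation. -/
theorem ModalForm.evalException_of_boxIter {n k : ℕ} {φ : ModalForm} (hφ : φ.evalRefl = true)
    (h : (boxIter k φ).evalException n = true) : φ.evalException n = true := by
  induction k with
  | zero => exact h
  | succ k ih =>
    have hk : (boxIter k φ).evalRefl = true := by rw [evalRefl_boxIter, hφ]
    simp only [boxIter, evalException, Bool.or_eq_true, decide_eq_true_eq,
      Bool.and_eq_true] at h
    rcases h with (h | h) | h
    · simp [h, evalRefl] at hk
    · simp [h, evalRefl_boxIter, evalRefl] at hk
    · exact ih h.2

theorem ModalForm.evalException_of_boxIter_self {n : ℕ} (hn : 2 ≤ n) {φ : ModalForm}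
    (h : (boxIter n φ).evalException n = true) : φ.evalException n = true := by
  obtain ⟨k, rfl⟩ := Nat.exists_eq_add_of_le' hn
  have h' := h
  rw [boxIter] at h'
  simp only [evalException, Bool.or_eq_true, decide_eq_true_eq, Bool.and_eq_true] at h'
  rcases h' with (h' | h') | h'
  · simp [boxIter] at h'
  · rw [boxIter_succ_eq (k + 1)] at h'
    simp [boxIter_injective _ h', evalException]
  · exact evalException_of_boxIter (by simpa [evalRefl_boxIter] using h'.1) h

theorem NA.eval_eq_true {n : ℕ} (hn : 2 ≤ n) {φ : ModalForm} (h : NA 0 n φ) :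
    φ.evalRefl = true ∧ φ.evalException n = true := by
  induction h with
  | taut p σ hp =>
    exact ⟨(p.evalRefl_subst σ).trans (hp _), (p.evalException_subst n σ).trans (hp _)⟩
  | amn φ =>
    refine ⟨?_, ?_⟩
    · simp [ModalForm.evalRefl, ModalForm.evalRefl_boxIter]
    · have := ModalForm.evalException_of_boxIter_self hn (φ := φ)
      simp only [ModalForm.evalException, ModalForm.boxIter]
      cases h : (ModalForm.boxIter n φ).evalException n <;> simp_all
  | mp φ ψ _ _ ih₁ ih₂ => simp_all [ModalForm.evalRefl, ModalForm.evalException]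
  | nec φ _ ih => simp_all [ModalForm.evalRefl, ModalForm.evalException]

theorem ModalForm.evalException_boxIter_fls (n : ℕ) :
    (boxIter (n + 1) .fls).evalException n = true := by
  simp [boxIter, evalException]

theorem NpA.neg_boxIter_fls {n : ℕ} (hn : 1 ≤ n) :
    NpA 0 n (ModalForm.neg (ModalForm.boxIter (n + 1) .fls)) := by
  obtain ⟨k, rfl⟩ := Nat.exists_eq_add_of_le' hn
  exact NpA.rosbox _ (NpA.amn .fls)

/-- For n ≥ 2, the inclusion of NA0n in NpA0n is strict. -/
theorem NpA_strict_over_NA (n : ℕ) (hn : 2 ≤ n) :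
    ∃ φ : ModalForm, NpA 0 n φ ∧ ¬ NA 0 n φ := by
  refine ⟨_, NpA.neg_boxIter_fls (by omega), fun h => ?_⟩
  have h₂ := (h.eval_eq_true hn).2
  simp [ModalForm.neg, ModalForm.evalException, ModalForm.evalException_boxIter_fls] at h₂
end

section
/- For all natural numbers m and n, none of the logics NAmn, NpAmn, and NRAmn is locally tabular; in particular, for every pair of distinct natural numbers k and l and any propositional variable p, the formula □(¬^{2k} p) ↔ □(¬^{2l} p) is not provable in NRAmn (and hence not in NAmn or NpAmn, which are included in NRAmn). -/
/-- The logic NRAmn = NAmn + (Ros : from ¬φ infer ¬□φ). -/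
inductive NRA (m n : ℕ) : ModalForm → Prop
  | taut (p : PropForm) (σ : ℕ → ModalForm) : p.Taut → NRA m n (p.subst σ)
  | amn (φ : ModalForm) : NRA m n (.imp (ModalForm.boxIter n φ) (ModalForm.boxIter m φ))
  | mp (φ ψ : ModalForm) : NRA m n (.imp φ ψ) → NRA m n φ → NRA m n ψ
  | nec (φ : ModalForm) : NRA m n φ → NRA m n (.box φ)
  | ros (φ : ModalForm) : NRA m n (ModalForm.neg φ) → NRA m n (ModalForm.neg (.box φ))

theorem PropForm.eval_congr_subst (σ : ℕ → ModalForm) (e : ModalForm → Bool)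
    (hfls : e .fls = false)
    (hand : ∀ φ ψ, e (.and φ ψ) = (e φ && e ψ))
    (hor : ∀ φ ψ, e (.or φ ψ) = (e φ || e ψ))
    (himp : ∀ φ ψ, e (.imp φ ψ) = (!e φ || e ψ)) (q : PropForm) :
    e (q.subst σ) = q.eval (fun i => e (σ i)) := by
  induction q with
  | var i => rfl
  | fls => exact hfls
  | and φ ψ ih₁ ih₂ => simp [PropForm.subst, PropForm.eval, hand, ih₁, ih₂]
  | or φ ψ ih₁ ih₂ => simp [PropForm.subst, PropForm.eval, hor, ih₁, ih₂]
  | imp φ ψ ih₁ ih₂ => simp [PropForm.subst, PropForm.eval, himp, ih₁, ih₂]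

namespace ModalForm

/-- Truth at the world `w` of the two-world model in which every variable is true exactly at the
world `true`, and `□` is the identity except that `□θ` has the constant value `c`. -/
def evalAt (θ : ModalForm) (c w : Bool) : ModalForm → Bool
  | .var _ => w
  | .fls => false
  | .and φ ψ => evalAt θ c w φ && evalAt θ c w ψ
  | .or φ ψ => evalAt θ c w φ || evalAt θ c w ψ
  | .imp φ ψ => !evalAt θ c w φ || evalAt θ c w ψ
  | .box φ => if φ = θ then c else evalAt θ c w φ

theorem evalAt_iff {θ : ModalForm} {c w : Bool} {φ ψ : ModalForm} :
    evalAt θ c w (φ.iff ψ) = true ↔ evalAt θ c w φ = evalAt θ c w ψ := by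
  simp only [ModalForm.iff, evalAt]
  cases evalAt θ c w φ <;> cases evalAt θ c w ψ <;> simp

theorem evalAt_negIter (θ : ModalForm) (c w : Bool) (k p : ℕ) :
    evalAt θ c w (negIter (2 * k) (.var p)) = w := by
  induction k with
  | zero => rfl
  | succ k ih => simp [Nat.mul_succ, negIter, neg, evalAt, ih]

theorem evalAt_boxIter_succ {θ : ModalForm} (hθ : ∀ φ, θ ≠ .box φ) (c w : Bool) (j : ℕ)
    (φ : ModalForm) : evalAt θ c w (boxIter (j + 1) φ) = evalAt θ c w (.box φ) := by
  induction j with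
  | zero => rfl
  | succ j ih =>
    rw [← ih]
    conv_lhs => rw [boxIter, evalAt]
    rw [if_neg]
    exact fun h => hθ _ h.symm

theorem negIter_var_ne_box (j p : ℕ) (φ : ModalForm) : negIter j (.var p) ≠ .box φ := by
  cases j <;> simp [negIter, neg]

theorem negIter_var_injective (p : ℕ) : Function.Injective fun j => negIter j (.var p) := by
  intro i
  induction i with
  | zero => intro j h; cases j <;> simp_all [negIter, neg]
  | succ i ih =>
    intro j h
    cases j with
    | zero => simp [negIter, neg] at h
    | succ j =>
      simp only [negIter, neg, imp.injEq, and_true] at h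
      rw [ih h]

theorem Vsgn_negIter_subset (j p : ℕ) (b : Bool) : (negIter j (.var p)).Vsgn b ⊆ {p} := by
  induction j generalizing b with
  | zero => cases b <;> simp [negIter, Vsgn]
  | succ j ih => simpa [negIter, neg, Vsgn] using ih (!b)

theorem V_box_negIter_subset (j p : ℕ) : (box (negIter j (.var p))).V ⊆ {p} :=
  Finset.union_subset (Vsgn_negIter_subset j p true) (Vsgn_negIter_subset j p false)

end ModalForm

open ModalForm

theorem NRA.evalAt_eq_true {m n : ℕ} {θ : ModalForm} {c : Bool} (hc : c = true ↔ n = 0)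
    (hθ : ∀ φ, θ ≠ .box φ) (hw : ∀ w, evalAt θ c w θ = w) {φ : ModalForm} (h : NRA m n φ)
    (w : Bool) : evalAt θ c w φ = true := by
  induction h generalizing w with
  | taut q σ hq =>
    rw [PropForm.eval_congr_subst σ (evalAt θ c w) rfl (fun _ _ => rfl) (fun _ _ => rfl)
      (fun _ _ => rfl)]
    exact hq _
  | amn φ =>
    simp only [evalAt]
    rcases n with _ | n
    · obtain rfl : c = true := hc.2 rfl
      rcases m with _ | m
      · simp
      · rw [evalAt_boxIter_succ hθ]
        by_cases hφ : φ = θ <;> simp [boxIter, evalAt, hφ]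
    · obtain rfl : c = false := by simpa using hc
      rw [evalAt_boxIter_succ hθ]
      rcases m with _ | m
      · by_cases hφ : φ = θ <;> simp [boxIter, evalAt, hφ]
      · simp [evalAt_boxIter_succ hθ]
  | mp φ ψ _ _ ih₁ ih₂ => simpa [evalAt, ih₂ w] using ih₁ w
  | nec φ _ ih =>
    have hne : φ ≠ θ := by
      rintro rfl
      simpa [hw] using ih false
    simpa [evalAt, hne] using ih w
  | ros φ _ ih =>
    have hne : φ ≠ θ := by
      rintro rfl
      simpa [neg, evalAt, hw] using ih true
    simpa [neg, evalAt, hne] using ih w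

theorem NRA.not_common_equiv {m n k l : ℕ} (hkl : k ≠ l) (p : ℕ) {χ : ModalForm}
    (hk : NRA m n ((box (negIter (2 * k) (.var p))).iff χ))
    (hl : NRA m n ((box (negIter (2 * l) (.var p))).iff χ)) : False := by
  set θ := negIter (2 * k) (.var p) with hθ
  have hne : negIter (2 * l) (.var p) ≠ θ := fun h =>
    hkl (by have := negIter_var_injective p h; omega)
  have key (w : Bool) : decide (n = 0) = w := by
    have hsound {φ : ModalForm} (h : NRA m n φ) : evalAt θ (decide (n = 0)) w φ = true :=
      h.evalAt_eq_true (by simp) (negIter_var_ne_box _ _) (fun w => evalAt_negIter _ _ w k p) w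
    have h := (evalAt_iff.1 (hsound hk)).trans (evalAt_iff.1 (hsound hl)).symm
    simpa only [evalAt, if_true, if_neg hne, evalAt_negIter] using h
  exact Bool.false_ne_true ((key false).symm.trans (key true))

theorem NRA.iff_refl (m n : ℕ) (φ : ModalForm) : NRA m n (φ.iff φ) :=
  NRA.taut (.and (.imp (.var 0) (.var 0)) (.imp (.var 0) (.var 0))) (fun _ => φ)
    (fun v => by simp [PropForm.eval])

theorem NA.toNRA {m n : ℕ} {φ : ModalForm} (h : NA m n φ) : NRA m n φ := by
  induction h with
  | taut q σ hq => exact .taut q σ hq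
  | amn φ => exact .amn φ
  | mp φ ψ _ _ ih₁ ih₂ => exact .mp φ ψ ih₁ ih₂
  | nec φ _ ih => exact .nec φ ih

theorem NpA.toNRA {m n : ℕ} {φ : ModalForm} (h : NpA m n φ) : NRA m n φ := by
  induction h with
  | taut q σ hq => exact .taut q σ hq
  | amn φ => exact .amn φ
  | mp φ ψ _ _ ih₁ ih₂ => exact .mp φ ψ ih₁ ih₂
  | nec φ _ ih => exact .nec φ ih
  | rosbox φ _ ih => exact .ros (.box φ) ih

theorem LocallyTabular.mono {L L' : ModalForm → Prop} (hL : ∀ φ, L φ → L' φ)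
    (h : LocallyTabular L) : LocallyTabular L' := fun P =>
  let ⟨S, hS⟩ := h P
  ⟨S, fun φ hφ => let ⟨χ, hχ, e⟩ := hS φ hφ; ⟨χ, hχ, hL _ e⟩⟩

theorem NRA.not_locallyTabular (m n : ℕ) : ¬ LocallyTabular (NRA m n) := by
  intro h
  obtain ⟨S, hS⟩ := h {0}
  choose f hfS hf using fun k : ℕ =>
    hS (box (negIter (2 * k) (.var 0))) (V_box_negIter_subset (2 * k) 0)
  obtain ⟨k, l, hkl, he⟩ :=
    Finite.exists_ne_map_eq_of_infinite fun k : ℕ => (⟨f k, hfS k⟩ : S)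
  have he : f k = f l := congrArg Subtype.val he
  exact NRA.not_common_equiv hkl 0 (hf k) (he ▸ hf l)

/-- None of NAmn, NpAmn, NRAmn is locally tabular; in particular
□(¬^{2k} p) ↔ □(¬^{2l} p) is unprovable in all three whenever k ≠ l. -/
theorem not_locally_tabular (m n : ℕ) :
    ¬ LocallyTabular (NA m n) ∧ ¬ LocallyTabular (NpA m n) ∧
    ¬ LocallyTabular (NRA m n) ∧
    ∀ k l : ℕ, k ≠ l → ∀ p : ℕ,
      ¬ NRA m n ((ModalForm.box (ModalForm.negIter (2 * k) (.var p))).iff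
          (ModalForm.box (ModalForm.negIter (2 * l) (.var p)))) ∧
      ¬ NA m n ((ModalForm.box (ModalForm.negIter (2 * k) (.var p))).iff
          (ModalForm.box (ModalForm.negIter (2 * l) (.var p)))) ∧
      ¬ NpA m n ((ModalForm.box (ModalForm.negIter (2 * k) (.var p))).iff
          (ModalForm.box (ModalForm.negIter (2 * l) (.var p)))) := by
  have key {k l : ℕ} (hkl : k ≠ l) (p : ℕ) :
      ¬ NRA m n ((ModalForm.box (ModalForm.negIter (2 * k) (.var p))).iff
          (ModalForm.box (ModalForm.negIter (2 * l) (.var p)))) :=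
    fun h => NRA.not_common_equiv hkl p h (NRA.iff_refl m n _)
  exact ⟨fun h => NRA.not_locallyTabular m n (h.mono fun _ => NA.toNRA),
    fun h => NRA.not_locallyTabular m n (h.mono fun _ => NpA.toNRA),
    NRA.not_locallyTabular m n,
    fun _ _ hkl p => ⟨key hkl p, fun h => key hkl p h.toNRA, fun h => key hkl p h.toNRA⟩⟩
end
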